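/- arXiv:0708.0300 — 12 statements merged into one kernel-verified Lean document; each statement's English description precedes it below -/
import Mathlib

section
/- Let p > 0 with p ≠ 1, let I ⊆ ℝ be an open interval, and let u : I → ℝ be differentiable with (p² − 1)·u′(θ) = p² + (p² + 1)·u(θ)² + u(θ)⁴ for all θ ∈ I. Then the function θ ↦ arctan(u(θ)) − (1/p)·arctan(u(θ)/p) has derivative identically equal to 1 on I; consequently there is a constant C ∈ ℝ such that arctan(u(θ)) − (1/p)·arctan(u(θ)/p) = θ + C for all θ ∈ I. -/
open Real Set

/-- First integral of the ODE `(p² − 1)·u′ = p² + (p² + 1)u² + u⁴` on an open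
interval: the function `θ ↦ arctan(u θ) − (1/p)·arctan(u θ / p)` has derivative
identically `1`, hence equals `θ + C` for some constant `C`. -/
theorem stmt0 (p a b : ℝ) (hp : 0 < p) (hp1 : p ≠ 1)
    (u u' : ℝ → ℝ)
    (hu : ∀ θ ∈ Set.Ioo a b, HasDerivAt u (u' θ) θ)
    (hode : ∀ θ ∈ Set.Ioo a b,
      (p ^ 2 - 1) * u' θ = p ^ 2 + (p ^ 2 + 1) * u θ ^ 2 + u θ ^ 4) :
    (∀ θ ∈ Set.Ioo a b,
      HasDerivAt (fun θ => Real.arctan (u θ) - (1 / p) * Real.arctan (u θ / p)) 1 θ) ∧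
    ∃ C : ℝ, ∀ θ ∈ Set.Ioo a b,
      Real.arctan (u θ) - (1 / p) * Real.arctan (u θ / p) = θ + C := by
  have hderiv : ∀ θ ∈ Set.Ioo a b,
      HasDerivAt (fun θ => Real.arctan (u θ) - (1 / p) * Real.arctan (u θ / p)) 1 θ := by
    intro θ hθ
    have h := (hu θ hθ).arctan.sub (((hu θ hθ).div_const p).arctan.const_mul (1 / p))
    refine h.congr_deriv ?_
    have hp0 : p ≠ 0 := hp.ne'
    have h1 : 1 + u θ ^ 2 ≠ 0 := by positivity
    have h2 : p ^ 2 + u θ ^ 2 ≠ 0 := by positivity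
    have h3 : 1 / p * (1 / (1 + (u θ / p) ^ 2) * (u' θ / p)) = u' θ / (p ^ 2 + u θ ^ 2) := by
      have h4 : 1 + (u θ / p) ^ 2 = (p ^ 2 + u θ ^ 2) / p ^ 2 := by field_simp
      rw [h4]
      field_simp
    rw [h3, one_div_mul_eq_div, div_sub_div _ _ h1 h2, div_eq_one_iff_eq (mul_ne_zero h1 h2)]
    linear_combination hode θ hθ
  refine ⟨hderiv, ?_⟩
  have hsub : ∀ θ ∈ Set.Ioo a b, HasDerivAt
      (fun θ => Real.arctan (u θ) - (1 / p) * Real.arctan (u θ / p) - θ) 0 θ := by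
    intro θ hθ
    exact ((hderiv θ hθ).sub (hasDerivAt_id' θ)).congr_deriv (sub_self 1)
  obtain ⟨C, hC⟩ := isOpen_Ioo.exists_is_const_of_deriv_eq_zero isPreconnected_Ioo
    (fun θ hθ => (hsub θ hθ).differentiableAt.differentiableWithinAt)
    (fun θ hθ => (hsub θ hθ).deriv)
  exact ⟨C, fun θ hθ => by linarith [hC θ hθ]⟩
end

section
/- Let p > 0 with p ≠ 1, and on the interval I = (−π/(2p), π/(2p)) define u(s) = −p·tan(ps), θ(s) = s − arctan(p·tan(ps)), and r(s) = √((1 + p²) + (1 − p²)·cos(2ps)). Then for all s ∈ I: (i) θ′(s) = (1 − p²)·cos²(ps)/(cos²(ps) + p²·sin²(ps)), which is nonzero; (ii) r′(s) = u(s)·r(s)·θ′(s); and (iii) (p² − 1)·u′(s) = (p² + (p² + 1)·u(s)² + u(s)⁴)·θ′(s). In other words, the cycloid data (r, θ, u) solves, in the parameter s, the system d(log r)/dθ = u, (p² − 1)·du/dθ = p² + (p² + 1)u² + u⁴. -/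
open Real Set

/-- The cycloid data `u(s) = −p·tan(ps)`, `θ(s) = s − arctan(p·tan(ps))`,
`r(s) = √((1+p²)+(1−p²)cos(2ps))` solves, in the parameter `s` on
`(−π/(2p), π/(2p))`, the system `d(log r)/dθ = u`,
`(p²−1)·du/dθ = p² + (p²+1)u² + u⁴`. -/
theorem stmt1 (p : ℝ) (hp : 0 < p) (hp1 : p ≠ 1) :
    ∀ s ∈ Set.Ioo (-(Real.pi / (2 * p))) (Real.pi / (2 * p)),
      (HasDerivAt (fun s => s - Real.arctan (p * Real.tan (p * s)))
        ((1 - p ^ 2) * Real.cos (p * s) ^ 2 /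
          (Real.cos (p * s) ^ 2 + p ^ 2 * Real.sin (p * s) ^ 2)) s) ∧
      ((1 - p ^ 2) * Real.cos (p * s) ^ 2 /
          (Real.cos (p * s) ^ 2 + p ^ 2 * Real.sin (p * s) ^ 2) ≠ 0) ∧
      (HasDerivAt (fun s => Real.sqrt ((1 + p ^ 2) + (1 - p ^ 2) * Real.cos (2 * p * s)))
        ((-p * Real.tan (p * s)) *
          Real.sqrt ((1 + p ^ 2) + (1 - p ^ 2) * Real.cos (2 * p * s)) *
          ((1 - p ^ 2) * Real.cos (p * s) ^ 2 /
            (Real.cos (p * s) ^ 2 + p ^ 2 * Real.sin (p * s) ^ 2))) s) ∧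
      (∃ du : ℝ, HasDerivAt (fun s => -p * Real.tan (p * s)) du s ∧
        (p ^ 2 - 1) * du =
          (p ^ 2 + (p ^ 2 + 1) * (-p * Real.tan (p * s)) ^ 2 +
              (-p * Real.tan (p * s)) ^ 4) *
            ((1 - p ^ 2) * Real.cos (p * s) ^ 2 /
              (Real.cos (p * s) ^ 2 + p ^ 2 * Real.sin (p * s) ^ 2))) := by
  intro s hs
  have hps : p * s ∈ Set.Ioo (-(Real.pi / 2)) (Real.pi / 2) := by
    have h : p * (Real.pi / (2 * p)) = Real.pi / 2 := by field_simp
    have h₁ := mul_lt_mul_of_pos_left hs.1 hp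
    have h₂ := mul_lt_mul_of_pos_left hs.2 hp
    rw [mul_neg, h] at h₁
    rw [h] at h₂
    exact ⟨h₁, h₂⟩
  have hc : Real.cos (p * s) ≠ 0 := (Real.cos_pos_of_mem_Ioo hps).ne'
  have hsc := Real.sin_sq (p * s)
  have hD : 0 < Real.cos (p * s) ^ 2 + p ^ 2 * Real.sin (p * s) ^ 2 := by positivity
  have hp2 : 1 - p ^ 2 ≠ 0 := fun h =>
    hp1 ((pow_eq_one_iff_of_nonneg hp.le two_ne_zero).1 (by linarith))
  have hlin : HasDerivAt (fun s => p * s) p s := by simpa using (hasDerivAt_id s).const_mul p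
  have htan : HasDerivAt (fun s => Real.tan (p * s)) (1 / Real.cos (p * s) ^ 2 * p) s :=
    (Real.hasDerivAt_tan hc).comp s hlin
  have hr : (1 + p ^ 2) + (1 - p ^ 2) * Real.cos (2 * p * s) =
      2 * (Real.cos (p * s) ^ 2 + p ^ 2 * Real.sin (p * s) ^ 2) := by
    rw [mul_assoc, Real.cos_two_mul, hsc]
    ring
  refine ⟨?_, by positivity, ?_, -p * (1 / Real.cos (p * s) ^ 2 * p), htan.const_mul (-p), ?_⟩
  · refine ((hasDerivAt_id s).sub (htan.const_mul p).arctan).congr_deriv ?_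
    have hA : 1 + (p * Real.tan (p * s)) ^ 2 =
        (Real.cos (p * s) ^ 2 + p ^ 2 * Real.sin (p * s) ^ 2) / Real.cos (p * s) ^ 2 := by
      rw [Real.tan_eq_sin_div_cos]
      field_simp
    rw [hA]
    field_simp
    rw [hsc]
    ring
  · have hlin2 : HasDerivAt (fun s => 2 * p * s) (2 * p) s := by
      simpa using (hasDerivAt_id s).const_mul (2 * p)
    have hpos : 0 < (1 + p ^ 2) + (1 - p ^ 2) * Real.cos (2 * p * s) := by
      rw [hr]
      positivity
    refine (((hlin2.cos.const_mul (1 - p ^ 2)).const_add (1 + p ^ 2)).sqrt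
      hpos.ne').congr_deriv ?_
    have hsq := Real.sq_sqrt hpos.le
    have hsqrt := Real.sqrt_pos.2 hpos
    rw [hr] at hsq hsqrt ⊢
    rw [mul_assoc 2 p s, Real.sin_two_mul, Real.tan_eq_sin_div_cos]
    set R := Real.sqrt (2 * (Real.cos (p * s) ^ 2 + p ^ 2 * Real.sin (p * s) ^ 2))
    have hR := hsqrt.ne'
    field_simp
    rw [hsq]
    ring
  · rw [Real.tan_eq_sin_div_cos]
    field_simp
    have h4 : Real.sin (p * s) ^ 4 = (1 - Real.cos (p * s) ^ 2) ^ 2 := by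
      rw [← hsc]
      ring
    ring_nf
    simp only [h4, hsc]
    ring
end

section
/- For every real p > 0 and every real s with |ps| < π/2, the following identity of complex numbers holds: (1 − p)·e^{i(1+p)s} + (1 + p)·e^{i(1−p)s} = √(2·((1 + p²) + (1 − p²)·cos(2ps))) · exp(i·(s − arctan(p·tan(ps)))). In particular, the curve s ↦ r(s)e^{iθ(s)} with r(s) = √(2((1+p²)+(1−p²)cos(2ps))) and θ(s) = s − arctan(p·tan(ps)) coincides with the curve s ↦ (1 − p)e^{i(1+p)s} + (1 + p)e^{i(1−p)s}. -/
/-- Euler's formula for a shifted real angle. -/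
theorem exp_I_mul_ofReal_add (x y : ℝ) :
    Complex.exp (Complex.I * ((x + y : ℝ) : ℂ)) =
      Complex.exp (Complex.I * (x : ℂ)) *
        ((Real.cos y : ℂ) + (Real.sin y : ℂ) * Complex.I) := by
  rw [Complex.ofReal_add, mul_add, Complex.exp_add, mul_comm Complex.I (y : ℂ),
    Complex.exp_mul_I, Complex.ofReal_cos, Complex.ofReal_sin]

/-- The radius `√(2((1+p²)+(1−p²)cos 2a))` in terms of `tan a`. -/
theorem sqrt_radius_eq (p a : ℝ) (ha : 0 < Real.cos a) :
    Real.sqrt (2 * ((1 + p ^ 2) + (1 - p ^ 2) * Real.cos (2 * a))) =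
      2 * Real.cos a * Real.sqrt (1 + (p * Real.tan a) ^ 2) := by
  have h : 2 * ((1 + p ^ 2) + (1 - p ^ 2) * Real.cos (2 * a)) =
      (2 * Real.cos a) ^ 2 * (1 + (p * Real.tan a) ^ 2) := by
    rw [Real.cos_two_mul, Real.tan_eq_sin_div_cos]
    field_simp
    rw [Real.sin_sq]
    ring
  rw [h, Real.sqrt_mul (sq_nonneg _), Real.sqrt_sq (by positivity)]


/-- For `p > 0` and `|ps| < π/2`,
`(1−p)e^{i(1+p)s} + (1+p)e^{i(1−p)s}
  = √(2((1+p²)+(1−p²)cos(2ps))) · exp(i(s − arctan(p·tan(ps))))`. -/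
theorem stmt2 (p s : ℝ) (hp : 0 < p) (hs : |p * s| < Real.pi / 2) :
    ((1 : ℂ) - (p : ℂ)) * Complex.exp (Complex.I * (((1 + p) * s : ℝ) : ℂ)) +
      ((1 : ℂ) + (p : ℂ)) * Complex.exp (Complex.I * (((1 - p) * s : ℝ) : ℂ)) =
    ((Real.sqrt (2 * ((1 + p ^ 2) + (1 - p ^ 2) * Real.cos (2 * p * s))) : ℝ) : ℂ) *
      Complex.exp (Complex.I * ((s - Real.arctan (p * Real.tan (p * s)) : ℝ) : ℂ)) := by
  have hc : 0 < Real.cos (p * s) := Real.cos_pos_of_mem_Ioo (abs_lt.mp hs)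
  have hr := sqrt_radius_eq p (p * s) hc
  rw [← mul_assoc] at hr
  have hT : 0 < Real.sqrt (1 + (p * Real.tan (p * s)) ^ 2) := by positivity
  have hcos : Real.sqrt (2 * ((1 + p ^ 2) + (1 - p ^ 2) * Real.cos (2 * p * s))) *
      Real.cos (Real.arctan (p * Real.tan (p * s))) = 2 * Real.cos (p * s) := by
    rw [hr, Real.cos_arctan]
    field_simp
  have hsin : Real.sqrt (2 * ((1 + p ^ 2) + (1 - p ^ 2) * Real.cos (2 * p * s))) *
      Real.sin (Real.arctan (p * Real.tan (p * s))) = 2 * p * Real.sin (p * s) := by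
    rw [hr, Real.sin_arctan, ← Real.tan_mul_cos hc.ne']
    field_simp
  rw [show (1 + p) * s = s + p * s by ring, show (1 - p) * s = s + -(p * s) by ring,
    sub_eq_add_neg s, exp_I_mul_ofReal_add, exp_I_mul_ofReal_add, exp_I_mul_ofReal_add]
  simp only [Real.cos_neg, Real.sin_neg, Complex.ofReal_neg]
  have hcos' := congrArg Complex.ofReal hcos
  have hsin' := congrArg Complex.ofReal hsin
  simp only [Complex.ofReal_mul, Complex.ofReal_ofNat] at hcos' hsin'
  linear_combination -Complex.exp (Complex.I * (s : ℂ)) * hcos' +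
    Complex.exp (Complex.I * (s : ℂ)) * Complex.I * hsin'
end

section
/- Let m, n be positive integers with m ≠ n, let Γ_{m,n}(t) = (1/m)[(m+n)e^{i(m−n)t} + (m−n)e^{i(m+n)t}], and let d = gcd(m+n, |m−n|). Then Γ_{m,n}(t + 2π/d) = Γ_{m,n}(t) for all t ∈ ℝ, and 2π/d is the minimal positive period: every T > 0 with Γ_{m,n}(t + T) = Γ_{m,n}(t) for all t ∈ ℝ is an integer multiple of 2π/d. Hence on [0, 2π) the map Γ_{m,n} traverses its image d times (it is a d-fold covering of the cycloid c_{n/m}). -/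
theorem exp_I_mul_add_two_pi_div {q : ℤ} {d : ℕ} (hd : d ≠ 0) (hq : (d : ℤ) ∣ q) (t : ℝ) :
    Complex.exp (Complex.I * (((q : ℝ) * (t + 2 * Real.pi / (d : ℝ)) : ℝ) : ℂ)) =
      Complex.exp (Complex.I * (((q : ℝ) * t : ℝ) : ℂ)) := by
  obtain ⟨c, rfl⟩ := hq
  have hd' : (d : ℂ) ≠ 0 := by exact_mod_cast hd
  refine Complex.exp_eq_exp_iff_exists_int.2 ⟨c, ?_⟩
  push_cast
  field_simp

theorem exists_int_mul_two_pi_of_exp_I_mul_eq_one {x : ℝ}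
    (h : Complex.exp (Complex.I * (x : ℂ)) = 1) : ∃ a : ℤ, x = a * (2 * Real.pi) := by
  obtain ⟨a, ha⟩ := Complex.exp_eq_one_iff.1 h
  refine ⟨a, ?_⟩
  have h' : (x : ℂ) = a * (2 * Real.pi) :=
    mul_left_cancel₀ Complex.I_ne_zero (by rw [ha]; ring)
  exact_mod_cast h'

/-- A common period `T > 0` of two exponentials with integer frequencies `p`, `q` is a multiple
of `2π / gcd p q`. -/
theorem exists_nat_mul_two_pi_div_gcd {p q a b : ℤ} {T : ℝ} (hT : 0 < T)
    (hg : Int.gcd p q ≠ 0) (hp : (p : ℝ) * T = a * (2 * Real.pi))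
    (hq : (q : ℝ) * T = b * (2 * Real.pi)) :
    ∃ k : ℕ, T = (k : ℝ) * (2 * Real.pi / (Int.gcd p q : ℝ)) := by
  have hg' : (0 : ℝ) < (Int.gcd p q : ℝ) := by exact_mod_cast Nat.pos_of_ne_zero hg
  have hbez : (Int.gcd p q : ℝ) = p * Int.gcdA p q + q * Int.gcdB p q := by
    exact_mod_cast Int.gcd_eq_gcd_ab p q
  set j : ℤ := a * Int.gcdA p q + b * Int.gcdB p q with hj
  have hmul : (Int.gcd p q : ℝ) * T = j * (2 * Real.pi) := by
    rw [hbez, hj]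
    push_cast
    linear_combination (Int.gcdA p q : ℝ) * hp + (Int.gcdB p q : ℝ) * hq
  have hpos : (0 : ℝ) < j :=
    pos_of_mul_pos_left (hmul ▸ mul_pos hg' hT) Real.two_pi_pos.le
  lift j to ℕ using (by exact_mod_cast hpos.le) with k
  refine ⟨k, ?_⟩
  push_cast at hmul
  field_simp
  linear_combination hmul

/-- With `d = gcd(m+n, |m−n|)`, the cycloid `Γ_{m,n}` is periodic with period
`2π/d`, and `2π/d` is the minimal positive period: every positive period is an
integer multiple of `2π/d` (so `Γ_{m,n}` is a `d`-fold covering of its image). -/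
theorem stmt4 (m n : ℕ) (hm : 0 < m) (hn : 0 < n) (hmn : m ≠ n)
    (Γ : ℝ → ℂ)
    (hΓ : Γ = fun t : ℝ =>
      (1 / (m : ℂ)) * (((m : ℂ) + (n : ℂ)) *
          Complex.exp (Complex.I * ((((m : ℝ) - (n : ℝ)) * t : ℝ) : ℂ)) +
        ((m : ℂ) - (n : ℂ)) *
          Complex.exp (Complex.I * ((((m : ℝ) + (n : ℝ)) * t : ℝ) : ℂ))))
    (d : ℕ) (hd : d = Int.gcd ((m : ℤ) + (n : ℤ)) ((m : ℤ) - (n : ℤ))) :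
    (∀ t : ℝ, Γ (t + 2 * Real.pi / (d : ℝ)) = Γ t) ∧
    ∀ T : ℝ, 0 < T → (∀ t : ℝ, Γ (t + T) = Γ t) →
      ∃ k : ℕ, T = (k : ℝ) * (2 * Real.pi / (d : ℝ)) := by
  have hp : ((m : ℝ) + (n : ℝ)) = (((m : ℤ) + (n : ℤ) : ℤ) : ℝ) := by push_cast; ring
  have hq : ((m : ℝ) - (n : ℝ)) = (((m : ℤ) - (n : ℤ) : ℤ) : ℝ) := by push_cast; ring
  have hd0 : d ≠ 0 := by
    rw [hd]
    intro h
    have := (Int.gcd_eq_zero_iff.1 h).1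
    omega
  have hm' : (m : ℂ) ≠ 0 := by exact_mod_cast hm.ne'
  have hn' : (n : ℂ) ≠ 0 := by exact_mod_cast hn.ne'
  have hA : (m : ℂ) + (n : ℂ) ≠ 0 := by exact_mod_cast (by omega : m + n ≠ 0)
  have hB : (m : ℂ) - (n : ℂ) ≠ 0 := sub_ne_zero.2 (by exact_mod_cast hmn)
  subst hΓ
  refine ⟨fun t => ?_, fun T hT hper => ?_⟩
  · simp only [hp, hq]
    rw [exp_I_mul_add_two_pi_div hd0 (hd ▸ Int.gcd_dvd_right _ _),
      exp_I_mul_add_two_pi_div hd0 (hd ▸ Int.gcd_dvd_left _ _)]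
  · set E := Complex.exp (Complex.I * ((((m : ℝ) - (n : ℝ)) * T : ℝ) : ℂ)) with hE
    set F := Complex.exp (Complex.I * ((((m : ℝ) + (n : ℝ)) * T : ℝ) : ℂ)) with hF
    have key : ∀ t : ℝ, ((m : ℂ) + n) * (E - 1) +
        ((m : ℂ) - n) * (F - 1) * Complex.exp (Complex.I * ((2 * n * t : ℝ) : ℂ)) = 0 := by
      intro t
      have h := mul_left_cancel₀ (one_div_ne_zero hm') (hper t)
      have e1 : Complex.exp (Complex.I * ((((m : ℝ) - (n : ℝ)) * (t + T) : ℝ) : ℂ)) =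
          Complex.exp (Complex.I * ((((m : ℝ) - (n : ℝ)) * t : ℝ) : ℂ)) * E := by
        rw [hE, ← Complex.exp_add]; congr 1; push_cast; ring
      have e2 : Complex.exp (Complex.I * ((((m : ℝ) + (n : ℝ)) * (t + T) : ℝ) : ℂ)) =
          Complex.exp (Complex.I * ((((m : ℝ) - (n : ℝ)) * t : ℝ) : ℂ)) *
            Complex.exp (Complex.I * ((2 * n * t : ℝ) : ℂ)) * F := by
        rw [hF, ← Complex.exp_add, ← Complex.exp_add]; congr 1; push_cast; ring
      have e3 : Complex.exp (Complex.I * ((((m : ℝ) + (n : ℝ)) * t : ℝ) : ℂ)) =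
          Complex.exp (Complex.I * ((((m : ℝ) - (n : ℝ)) * t : ℝ) : ℂ)) *
            Complex.exp (Complex.I * ((2 * n * t : ℝ) : ℂ)) := by
        rw [← Complex.exp_add]; congr 1; push_cast; ring
      rw [e1, e2, e3] at h
      refine (mul_eq_zero.1 ?_).resolve_left
        (Complex.exp_ne_zero (Complex.I * ((((m : ℝ) - (n : ℝ)) * t : ℝ) : ℂ)))
      linear_combination h
    have h0 := key 0
    have h1 := key (Real.pi / (2 * n))
    have hexp : Complex.exp (Complex.I * ((2 * n * (Real.pi / (2 * n)) : ℝ) : ℂ)) = -1 := by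
      rw [← Complex.exp_pi_mul_I]; congr 1; push_cast; field_simp
    rw [hexp] at h1
    simp only [mul_zero, Complex.ofReal_zero, Complex.exp_zero] at h0
    have hE1 : E = 1 := mul_left_cancel₀ hA (by linear_combination (h0 + h1) / 2)
    have hF1 : F = 1 := mul_left_cancel₀ hB (by linear_combination (h0 - h1) / 2)
    obtain ⟨a, ha⟩ := exists_int_mul_two_pi_of_exp_I_mul_eq_one hF1
    obtain ⟨b, hb⟩ := exists_int_mul_two_pi_of_exp_I_mul_eq_one hE1
    rw [hp] at ha
    rw [hq] at hb
    subst hd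
    exact exists_nat_mul_two_pi_div_gcd hT hd0 ha hb
end

section
/- Let U ⊆ ℂ be open and E = (E_{ij}) : U → SL(2, ℂ) a holomorphic Legendrian map, i.e. each entry is holomorphic, det E(z) = 1, and E(z)⁻¹E′(z) is off-diagonal for all z ∈ U. Let z₀ ∈ U with E₂₁(z₀) ≠ 0 and E₂₂(z₀) ≠ 0, and set G = E₁₁/E₂₁ and G_* = E₁₂/E₂₂ near z₀ (then G(z₀) ≠ G_*(z₀)). Then E′(z₀)·E(z₀)⁻¹ = (G(z₀) − G_*(z₀))⁻² · M, where M is the 2×2 matrix with entries M₁₁ = −(G_*·G′ + G·G_*′), M₁₂ = G_*²·G′ + G²·G_*′, M₂₁ = −(G′ + G_*′), M₂₂ = G_*·G′ + G·G_*′, all evaluated at z₀. -/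
open Matrix

/-- For a holomorphic Legendrian map `E : U → SL(2,ℂ)` with hyperbolic Gauss
maps `G = E₁₁/E₂₁`, `G_* = E₁₂/E₂₂`, at a point where `E₂₁ ≠ 0` and `E₂₂ ≠ 0`
one has `G ≠ G_*` and
`E′E⁻¹ = (G − G_*)⁻² · [[−(G_*G′+GG_*′), G_*²G′+G²G_*′], [−(G′+G_*′), G_*G′+GG_*′]]`. -/
theorem stmt5 (U : Set ℂ) (hU : IsOpen U)
    (E E' : ℂ → Matrix (Fin 2) (Fin 2) ℂ)
    (hE' : ∀ z ∈ U, ∀ i j : Fin 2, HasDerivAt (fun w => E w i j) (E' z i j) z)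
    (hdet : ∀ z ∈ U, (E z).det = 1)
    (hLeg : ∀ z ∈ U, ∀ i : Fin 2, ((E z)⁻¹ * E' z) i i = 0)
    (z₀ : ℂ) (hz₀ : z₀ ∈ U)
    (h21 : E z₀ 1 0 ≠ 0) (h22 : E z₀ 1 1 ≠ 0)
    (G Gs : ℂ → ℂ)
    (hG : G = fun z => E z 0 0 / E z 1 0)
    (hGs : Gs = fun z => E z 0 1 / E z 1 1) :
    G z₀ ≠ Gs z₀ ∧
    E' z₀ * (E z₀)⁻¹ =
      ((G z₀ - Gs z₀) ^ 2)⁻¹ •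
        !![-(Gs z₀ * deriv G z₀ + G z₀ * deriv Gs z₀),
            Gs z₀ ^ 2 * deriv G z₀ + G z₀ ^ 2 * deriv Gs z₀;
           -(deriv G z₀ + deriv Gs z₀),
            Gs z₀ * deriv G z₀ + G z₀ * deriv Gs z₀] := by
  have det_eq := hdet z₀ hz₀
  rw [det_fin_two] at det_eq
  have inv_eq : (E z₀)⁻¹ = !![E z₀ 1 1, -E z₀ 0 1; -E z₀ 1 0, E z₀ 0 0] := by
    rw [inv_def, hdet z₀ hz₀, adjugate_fin_two]
    simp
  have leg₀ := hLeg z₀ hz₀ 0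
  have leg₁ := hLeg z₀ hz₀ 1
  simp only [inv_eq, mul_apply, Fin.sum_univ_two, of_apply, cons_val', cons_val_zero,
    cons_val_one, cons_val_fin_one] at leg₀ leg₁
  have derivG := ((hE' z₀ hz₀ 0 0).div (hE' z₀ hz₀ 1 0) h21).deriv
  have derivGs := ((hE' z₀ hz₀ 0 1).div (hE' z₀ hz₀ 1 1) h22).deriv
  change deriv (fun z => E z 0 0 / E z 1 0) z₀ = _ at derivG
  change deriv (fun z => E z 0 1 / E z 1 1) z₀ = _ at derivGs
  rw [← hG] at derivG
  rw [← hGs] at derivGs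
  have G_eq : G z₀ = E z₀ 0 0 / E z₀ 1 0 := by rw [hG]
  have Gs_eq : Gs z₀ = E z₀ 0 1 / E z₀ 1 1 := by rw [hGs]
  rw [inv_eq, eta_fin_two (E' z₀), derivG, derivGs, G_eq, Gs_eq]
  generalize E z₀ 0 0 = a at *
  generalize E z₀ 0 1 = b at *
  generalize E z₀ 1 0 = c at *
  generalize E z₀ 1 1 = d at *
  generalize E' z₀ 0 0 = a' at *
  generalize E' z₀ 0 1 = b' at *
  generalize E' z₀ 1 0 = c' at *
  generalize E' z₀ 1 1 = d' at *
  have diff_eq : a / c - b / d = (c * d)⁻¹ := by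
    field_simp
    linear_combination det_eq
  have a'_eq : a' = b * c' / d := by
    field_simp
    linear_combination leg₀
  have b'_eq : b' = a * d' / c := by
    field_simp
    linear_combination -leg₁
  have quotG : (a' * c - a * c') / c ^ 2 = -c' / (c ^ 2 * d) := by
    rw [a'_eq]
    field_simp
    linear_combination -c' * det_eq
  have quotGs : (b' * d - b * d') / d ^ 2 = d' / (d ^ 2 * c) := by
    rw [b'_eq]
    field_simp
    linear_combination d' * det_eq
  refine ⟨sub_ne_zero.mp (diff_eq ▸ inv_ne_zero (mul_ne_zero h21 h22)), ?_⟩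
  rw [quotG, quotGs, diff_eq, a'_eq, b'_eq]
  ext i j
  fin_cases i <;> fin_cases j <;>
    simp [mul_apply, Fin.sum_univ_two] <;> field_simp <;> ring
end

section
/- Let U ⊆ ℂ be open and E = (E_{ij}) : U → SL(2, ℂ) a holomorphic Legendrian map, and write E(z)⁻¹E′(z) = [[0, θ̂(z)], [ω̂(z), 0]]. Let z₀ ∈ U with E₂₁(z₀) ≠ 0 and E₂₂(z₀) ≠ 0, and set G = E₁₁/E₂₁, G_* = E₁₂/E₂₂ near z₀. Then at z₀: (i) G − G_* = 1/(E₂₁·E₂₂); (ii) ω̂ = −G′·E₂₁²; (iii) θ̂ = G_*′·E₂₂²; and consequently (iv) ω̂·θ̂ = −G′·G_*′/(G − G_*)². -/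
open Matrix

/-- For a holomorphic Legendrian map `E` with `E⁻¹E′ = [[0, θ̂],[ω̂, 0]]` and
Gauss maps `G = E₁₁/E₂₁`, `G_* = E₁₂/E₂₂`, at a point where `E₂₁ ≠ 0`, `E₂₂ ≠ 0`:
`G − G_* = 1/(E₂₁E₂₂)`, `ω̂ = −G′E₂₁²`, `θ̂ = G_*′E₂₂²`, and
`ω̂θ̂ = −G′G_*′/(G − G_*)²`. -/
theorem stmt6 (U : Set ℂ) (hU : IsOpen U)
    (E E' : ℂ → Matrix (Fin 2) (Fin 2) ℂ)
    (hE' : ∀ z ∈ U, ∀ i j : Fin 2, HasDerivAt (fun w => E w i j) (E' z i j) z)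
    (hdet : ∀ z ∈ U, (E z).det = 1)
    (θh ωh : ℂ → ℂ)
    (hθω : ∀ z ∈ U, (E z)⁻¹ * E' z = !![0, θh z; ωh z, 0])
    (z₀ : ℂ) (hz₀ : z₀ ∈ U)
    (h21 : E z₀ 1 0 ≠ 0) (h22 : E z₀ 1 1 ≠ 0)
    (G Gs : ℂ → ℂ)
    (hG : G = fun z => E z 0 0 / E z 1 0)
    (hGs : Gs = fun z => E z 0 1 / E z 1 1) :
    (G z₀ - Gs z₀ = 1 / (E z₀ 1 0 * E z₀ 1 1)) ∧
    (ωh z₀ = -(deriv G z₀) * (E z₀ 1 0) ^ 2) ∧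
    (θh z₀ = deriv Gs z₀ * (E z₀ 1 1) ^ 2) ∧
    (ωh z₀ * θh z₀ = -(deriv G z₀ * deriv Gs z₀) / (G z₀ - Gs z₀) ^ 2) := by
  subst hG hGs
  have det_eq : E z₀ 0 0 * E z₀ 1 1 - E z₀ 0 1 * E z₀ 1 0 = 1 := by
    rw [← det_fin_two, hdet z₀ hz₀]
  have hmul : E' z₀ = E z₀ * !![0, θh z₀; ωh z₀, 0] := by
    rw [← hθω z₀ hz₀, mul_nonsing_inv_cancel_left _ _ (by simp [hdet z₀ hz₀])]
  have h00 : E' z₀ 0 0 = E z₀ 0 1 * ωh z₀ := by simp [hmul, mul_apply]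
  have h01 : E' z₀ 0 1 = E z₀ 0 0 * θh z₀ := by simp [hmul, mul_apply]
  have h10 : E' z₀ 1 0 = E z₀ 1 1 * ωh z₀ := by simp [hmul, mul_apply]
  have h11 : E' z₀ 1 1 = E z₀ 1 0 * θh z₀ := by simp [hmul, mul_apply]
  have hG' : deriv (fun z => E z 0 0 / E z 1 0) z₀ = -ωh z₀ / E z₀ 1 0 ^ 2 := by
    rw [((hE' z₀ hz₀ 0 0).fun_div (hE' z₀ hz₀ 1 0) h21).deriv, h00, h10]
    congr 1
    linear_combination -ωh z₀ * det_eq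
  have hGs' : deriv (fun z => E z 0 1 / E z 1 1) z₀ = θh z₀ / E z₀ 1 1 ^ 2 := by
    rw [((hE' z₀ hz₀ 0 1).fun_div (hE' z₀ hz₀ 1 1) h22).deriv, h01, h11]
    congr 1
    linear_combination θh z₀ * det_eq
  have hdiff : E z₀ 0 0 / E z₀ 1 0 - E z₀ 0 1 / E z₀ 1 1 = 1 / (E z₀ 1 0 * E z₀ 1 1) := by
    rw [div_sub_div _ _ h21 h22]
    congr 1
    linear_combination det_eq
  refine ⟨hdiff, ?_, ?_, ?_⟩
  · rw [hG']
    field_simp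
  · rw [hGs']
    field_simp
  · beta_reduce
    rw [hG', hGs', hdiff]
    field_simp
end

section
/- Let U ⊆ ℂ be open and E = (E_{ij}) : U → SL(2, ℂ) a holomorphic Legendrian map with E(z)⁻¹E′(z) = [[0, θ̂(z)], [ω̂(z), 0]]. Suppose that on a neighborhood V of a point z₀ we have E₂₁ ≠ 0, ω̂ ≠ 0 (equivalently G′ ≠ 0, where G = E₁₁/E₂₁), and let g be a holomorphic function on V with g′ = ω̂. Then S(g) − S(G) = 2·ω̂·θ̂ on V, where for a holomorphic function h with h′ ≠ 0 the Schwarzian derivative coefficient is S(h) = (h″/h′)′ − (1/2)(h″/h′)². -/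
open Matrix

/-- The Schwarzian-derivative coefficient `S(h) = (h″/h′)′ − (1/2)(h″/h′)²`. -/
noncomputable def schwarzian (h : ℂ → ℂ) (z : ℂ) : ℂ :=
  deriv (fun w => deriv (deriv h) w / deriv h w) z -
    (1 / 2) * (deriv (deriv h) z / deriv h z) ^ 2

/-- The Schwarzian coefficient expressed through the logarithmic derivative of the first
derivative. -/
theorem schwarzian_eq_of_eqOn {V : Set ℂ} (hV : IsOpen V) {h p : ℂ → ℂ} {p' z : ℂ} (hz : z ∈ V)
    (hp : ∀ w ∈ V, deriv (deriv h) w / deriv h w = p w) (hp' : HasDerivAt p p' z) :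
    schwarzian h z = p' - (1 / 2) * p z ^ 2 := by
  have hd : deriv (fun w => deriv (deriv h) w / deriv h w) z = p' :=
    (hp'.congr_of_eventuallyEq (Filter.eventuallyEq_of_mem (hV.mem_nhds hz) hp)).deriv
  rw [schwarzian, hd, hp z hz]

/-- For a holomorphic Legendrian map `E` with `E⁻¹E′ = [[0, θ̂],[ω̂, 0]]`,
Gauss map `G = E₁₁/E₂₁`, and a primitive `g` of `ω̂` on a neighborhood `V` of
`z₀` on which `E₂₁ ≠ 0` and `ω̂ ≠ 0`, one has `S(g) − S(G) = 2ω̂θ̂` on `V`. -/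
theorem stmt7 (U : Set ℂ) (hU : IsOpen U)
    (E E' : ℂ → Matrix (Fin 2) (Fin 2) ℂ)
    (hE' : ∀ z ∈ U, ∀ i j : Fin 2, HasDerivAt (fun w => E w i j) (E' z i j) z)
    (hdet : ∀ z ∈ U, (E z).det = 1)
    (θh ωh : ℂ → ℂ)
    (hθω : ∀ z ∈ U, (E z)⁻¹ * E' z = !![0, θh z; ωh z, 0])
    (V : Set ℂ) (hV : IsOpen V) (hVU : V ⊆ U) (z₀ : ℂ) (hz₀ : z₀ ∈ V)
    (h21 : ∀ z ∈ V, E z 1 0 ≠ 0) (hω : ∀ z ∈ V, ωh z ≠ 0)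
    (G : ℂ → ℂ) (hG : G = fun z => E z 0 0 / E z 1 0)
    (g : ℂ → ℂ) (hg : ∀ z ∈ V, HasDerivAt g (ωh z) z) :
    ∀ z ∈ V, schwarzian g z - schwarzian G z = 2 * ωh z * θh z := by
  have hdet' : ∀ z ∈ U, E z 0 0 * E z 1 1 - E z 0 1 * E z 1 0 = 1 := fun z hz => by
    rw [← det_fin_two, hdet z hz]
  have hmul : ∀ z ∈ U, E' z = E z * !![0, θh z; ωh z, 0] := fun z hz => by
    rw [← hθω z hz, mul_nonsing_inv_cancel_left _ _ (by simp [hdet z hz])]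
  have ha : ∀ z ∈ U, HasDerivAt (fun w => E w 0 0) (E z 0 1 * ωh z) z := fun z hz => by
    simpa [hmul z hz, mul_apply] using hE' z hz 0 0
  have hc : ∀ z ∈ U, HasDerivAt (fun w => E w 1 0) (E z 1 1 * ωh z) z := fun z hz => by
    simpa [hmul z hz, mul_apply] using hE' z hz 1 0
  have hd : ∀ z ∈ U, HasDerivAt (fun w => E w 1 1) (E z 1 0 * θh z) z := fun z hz => by
    simpa [hmul z hz, mul_apply] using hE' z hz 1 1
  have hg' : Set.EqOn (deriv g) ωh V := fun z hz => (hg z hz).deriv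
  have hωdiff : DifferentiableOn ℂ ωh V :=
    (DifferentiableOn.deriv (fun z hz => (hg z hz).differentiableAt.differentiableWithinAt)
      hV).congr fun z hz => (hg' hz).symm
  have hω' : ∀ z ∈ V, HasDerivAt ωh (deriv ωh z) z := fun z hz =>
    (hωdiff.differentiableAt (hV.mem_nhds hz)).hasDerivAt
  have hω'' : ∀ z ∈ V, HasDerivAt (deriv ωh) (deriv (deriv ωh) z) z := fun z hz =>
    ((hωdiff.deriv hV).differentiableAt (hV.mem_nhds hz)).hasDerivAt
  have hG' : Set.EqOn (deriv G) (fun w => -ωh w / E w 1 0 ^ 2) V := fun z hz => by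
    have h := ((ha z (hVU hz)).fun_div (hc z (hVU hz)) (h21 z hz)).deriv
    rw [hG, h]
    congr 1
    linear_combination -ωh z * hdet' z (hVU hz)
  have hlogG : ∀ z ∈ V, deriv (deriv G) z / deriv G z =
      deriv ωh z / ωh z - 2 * (E z 1 1 * ωh z / E z 1 0) := fun z hz => by
    have h := ((hω' z hz).fun_neg.fun_div ((hc z (hVU hz)).fun_pow 2)
      (pow_ne_zero 2 (h21 z hz))).deriv
    have h1 := h21 z hz
    have h2 := hω z hz
    rw [hG'.deriv hV hz, h, hG' hz]
    field_simp
    push_cast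
    ring
  have hlogg : ∀ z ∈ V, deriv (deriv g) z / deriv g z = deriv ωh z / ωh z := fun z hz => by
    rw [hg'.deriv hV hz, hg' hz]
  intro z hz
  have h1 := h21 z hz
  have h2 := hω z hz
  have hL := (hω'' z hz).fun_div (hω' z hz) h2
  have hq := (((hd z (hVU hz)).fun_mul (hω' z hz)).fun_div (hc z (hVU hz)) h1).const_mul 2
  rw [schwarzian_eq_of_eqOn hV hz hlogg hL, schwarzian_eq_of_eqOn hV hz hlogG (hL.fun_sub hq)]
  field_simp
  ring
end

section
/- Let U ⊆ ℂ be open and E = (E_{ij}) : U → SL(2, ℂ) a holomorphic Legendrian map with E(z)⁻¹E′(z) = [[0, θ̂(z)], [ω̂(z), 0]], and set G = E₁₁/E₂₁, G_* = E₁₂/E₂₂ and ρ = θ̂/ω̂. At every point where E₂₁ ≠ 0, E₂₂ ≠ 0, G′ ≠ 0 and G_*′ ≠ 0 (so that ρ is defined and nonzero), the logarithmic derivative of ρ satisfies ρ′/ρ = G_*″/G_*′ − G″/G′ + 2·(G′ + G_*′)/(G − G_*). -/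
open Matrix

theorem eventually_hasDerivAt_div {f g f' g' q : ℂ → ℂ} {U : Set ℂ} {z : ℂ} (hU : IsOpen U)
    (hz : z ∈ U) (hf : ∀ w ∈ U, HasDerivAt f (f' w) w) (hg : ∀ w ∈ U, HasDerivAt g (g' w) w)
    (hq : ∀ w ∈ U, f' w * g w - f w * g' w = q w) (hgz : g z ≠ 0) :
    ∀ᶠ w in nhds z, HasDerivAt (fun w => f w / g w) (q w / g w ^ 2) w := by
  filter_upwards [hU.mem_nhds hz, (hg z hz).continuousAt.eventually_ne hgz] with w hw hgw
  exact hq w hw ▸ (hf w hw).fun_div (hg w hw) hgw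

theorem differentiableAt_of_forall_hasDerivAt {f f' : ℂ → ℂ} {U : Set ℂ} {z : ℂ} (hU : IsOpen U)
    (hz : z ∈ U) (hf : ∀ w ∈ U, HasDerivAt f (f' w) w) : DifferentiableAt ℂ f' z := by
  have hd : DifferentiableOn ℂ f U := fun w hw =>
    (hf w hw).differentiableAt.differentiableWithinAt
  have h : deriv f =ᶠ[nhds z] f' := by
    filter_upwards [hU.mem_nhds hz] with w hw using (hf w hw).deriv
  exact h.differentiableAt_iff.1 ((hd.deriv hU).differentiableAt (hU.mem_nhds hz))

/-- For a holomorphic Legendrian map `E` with `E⁻¹E′ = [[0, θ̂],[ω̂, 0]]`, Gauss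
maps `G = E₁₁/E₂₁`, `G_* = E₁₂/E₂₂` and `ρ = θ̂/ω̂`, at every point where
`E₂₁ ≠ 0`, `E₂₂ ≠ 0`, `G′ ≠ 0`, `G_*′ ≠ 0` one has
`ρ′/ρ = G_*″/G_*′ − G″/G′ + 2(G′ + G_*′)/(G − G_*)`. -/
theorem stmt8 (U : Set ℂ) (hU : IsOpen U)
    (E E' : ℂ → Matrix (Fin 2) (Fin 2) ℂ)
    (hE' : ∀ z ∈ U, ∀ i j : Fin 2, HasDerivAt (fun w => E w i j) (E' z i j) z)
    (hdet : ∀ z ∈ U, (E z).det = 1)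
    (θh ωh : ℂ → ℂ)
    (hθω : ∀ z ∈ U, (E z)⁻¹ * E' z = !![0, θh z; ωh z, 0])
    (G Gs ρ : ℂ → ℂ)
    (hG : G = fun z => E z 0 0 / E z 1 0)
    (hGs : Gs = fun z => E z 0 1 / E z 1 1)
    (hρ : ρ = fun z => θh z / ωh z)
    (z₀ : ℂ) (hz₀ : z₀ ∈ U)
    (h21 : E z₀ 1 0 ≠ 0) (h22 : E z₀ 1 1 ≠ 0)
    (hG' : deriv G z₀ ≠ 0) (hGs' : deriv Gs z₀ ≠ 0) :
    deriv ρ z₀ / ρ z₀ =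
      deriv (deriv Gs) z₀ / deriv Gs z₀ - deriv (deriv G) z₀ / deriv G z₀ +
        2 * (deriv G z₀ + deriv Gs z₀) / (G z₀ - Gs z₀) := by
  have hmul : ∀ z ∈ U, E' z = E z * !![0, θh z; ωh z, 0] := fun z hz => by
    rw [← hθω z hz, Matrix.mul_nonsing_inv_cancel_left _ _ (by simp [hdet z hz])]
  have hdet' : ∀ z ∈ U, E z 0 0 * E z 1 1 - E z 0 1 * E z 1 0 = 1 := fun z hz => by
    rw [← Matrix.det_fin_two, hdet z hz]
  have e00 : ∀ z ∈ U, E' z 0 0 = E z 0 1 * ωh z := fun z hz => by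
    simp [hmul z hz, Matrix.mul_apply]
  have e01 : ∀ z ∈ U, E' z 0 1 = E z 0 0 * θh z := fun z hz => by
    simp [hmul z hz, Matrix.mul_apply]
  have e10 : ∀ z ∈ U, E' z 1 0 = E z 1 1 * ωh z := fun z hz => by
    simp [hmul z hz, Matrix.mul_apply]
  have e11 : ∀ z ∈ U, E' z 1 1 = E z 1 0 * θh z := fun z hz => by
    simp [hmul z hz, Matrix.mul_apply]
  have hqG : ∀ z ∈ U, E' z 0 0 * E z 1 0 - E z 0 0 * E' z 1 0 = -ωh z := fun z hz => by
    rw [e00 z hz, e10 z hz]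
    linear_combination -ωh z * hdet' z hz
  have hqGs : ∀ z ∈ U, E' z 0 1 * E z 1 1 - E z 0 1 * E' z 1 1 = θh z := fun z hz => by
    rw [e01 z hz, e11 z hz]
    linear_combination θh z * hdet' z hz
  have hEd : ∀ i j, DifferentiableAt ℂ (fun z => E z i j) z₀ := fun i j =>
    (hE' z₀ hz₀ i j).differentiableAt
  have hEd' : ∀ i j, DifferentiableAt ℂ (fun z => E' z i j) z₀ := fun i j =>
    differentiableAt_of_forall_hasDerivAt hU hz₀ fun w hw => hE' w hw i j
  have hω : DifferentiableAt ℂ ωh z₀ := by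
    have h : (fun z => -(E' z 0 0 * E z 1 0 - E z 0 0 * E' z 1 0)) =ᶠ[nhds z₀] ωh := by
      filter_upwards [hU.mem_nhds hz₀] with z hz
      rw [hqG z hz, neg_neg]
    exact h.differentiableAt_iff.1
      (((hEd' 0 0).mul (hEd 1 0)).sub ((hEd 0 0).mul (hEd' 1 0))).neg
  have hθ : DifferentiableAt ℂ θh z₀ := by
    have h : (fun z => E' z 0 1 * E z 1 1 - E z 0 1 * E' z 1 1) =ᶠ[nhds z₀] θh := by
      filter_upwards [hU.mem_nhds hz₀] with z hz using hqGs z hz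
    exact h.differentiableAt_iff.1
      (((hEd' 0 1).mul (hEd 1 1)).sub ((hEd 0 1).mul (hEd' 1 1)))
  have dG : deriv G =ᶠ[nhds z₀] fun z => -ωh z / E z 1 0 ^ 2 := by
    rw [hG]
    exact (eventually_hasDerivAt_div hU hz₀ (fun w hw => hE' w hw 0 0)
      (fun w hw => hE' w hw 1 0) hqG h21).mono fun w hw => hw.deriv
  have dGs : deriv Gs =ᶠ[nhds z₀] fun z => θh z / E z 1 1 ^ 2 := by
    rw [hGs]
    exact (eventually_hasDerivAt_div hU hz₀ (fun w hw => hE' w hw 0 1)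
      (fun w hw => hE' w hw 1 1) hqGs h22).mono fun w hw => hw.deriv
  have hω0 : ωh z₀ ≠ 0 := fun h => hG' (by simp [dG.eq_of_nhds, h])
  have hθ0 : θh z₀ ≠ 0 := fun h => hGs' (by simp [dGs.eq_of_nhds, h])
  have ddG := (hω.hasDerivAt.fun_neg.fun_div ((hE' z₀ hz₀ 1 0).fun_pow 2)
    (pow_ne_zero 2 h21)).deriv
  have ddGs := (hθ.hasDerivAt.fun_div ((hE' z₀ hz₀ 1 1).fun_pow 2) (pow_ne_zero 2 h22)).deriv
  have dρ := (hθ.hasDerivAt.fun_div hω.hasDerivAt hω0).deriv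
  have hsub : G z₀ - Gs z₀ = 1 / (E z₀ 1 0 * E z₀ 1 1) := by
    rw [hG, hGs]
    field_simp
    linear_combination hdet' z₀ hz₀
  rw [hsub, dG.deriv_eq, dGs.deriv_eq, dG.eq_of_nhds, dGs.eq_of_nhds, ddG, ddGs, hρ, dρ,
    e10 z₀ hz₀, e11 z₀ hz₀]
  field_simp
  ring
end

section
/- Let m, l be positive integers with l ≠ m, and let α₁ ∈ ℂ with α₁ ≠ 0. Let G, G_* be holomorphic functions on a punctured neighborhood of 0 ∈ ℂ with G(z) = z^m and G_*(z) = −z^m + α₁·z^{m+l} + o(z^{m+l}) as z → 0, with G_* extending holomorphically to 0 and G ≠ G_* on the punctured neighborhood. Then lim_{z→0} z^{1−l} · [ G_*″(z)/G_*′(z) − G″(z)/G′(z) + 2·(G′(z) + G_*′(z))/(G(z) − G_*(z)) ] = (α₁/m)·(m + l)·(m − l), which is nonzero. Consequently the function ρ′/ρ = G_*″/G_*′ − G″/G′ + 2(G′ + G_*′)/(G − G_*) vanishes to order exactly l − 1 at z = 0. -/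
open Filter Topology Asymptotics

/-- A holomorphic function on a punctured neighbourhood of `0` that equals
`P z + a * z ^ n + o(z ^ n)` can be written `P z + z ^ n * h z` with `h` analytic at `0` and
`h 0 = a`. -/
theorem exists_analyticAt_eq_add_pow_mul {f P : ℂ → ℂ} {n : ℕ} {a : ℂ}
    (hf : ∀ᶠ z in 𝓝[≠] (0 : ℂ), DifferentiableAt ℂ f z) (hP : Differentiable ℂ P)
    (h : (fun z => f z - (P z + a * z ^ n)) =o[𝓝[≠] (0 : ℂ)] fun z => z ^ n) :
    ∃ g : ℂ → ℂ, AnalyticAt ℂ g 0 ∧ g 0 = a ∧ ∀ z, z ≠ 0 → f z = P z + z ^ n * g z := by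
  refine ⟨Function.update (fun z => (f z - P z) / z ^ n) 0 a, ?_, by simp, ?_⟩
  · apply Complex.analyticAt_of_differentiable_on_punctured_nhds_of_continuousAt
    · filter_upwards [hf, self_mem_nhdsWithin] with z hz (hz0 : z ≠ 0)
      have hd : DifferentiableAt ℂ (fun z => (f z - P z) / z ^ n) z :=
        (hz.sub (hP z)).div (by fun_prop) (pow_ne_zero n hz0)
      refine hd.congr_of_eventuallyEq ?_
      filter_upwards [isOpen_ne.mem_nhds hz0] with w hw
      exact Function.update_of_ne hw _ _
    · rw [continuousAt_update_same]
      have h1 := h.tendsto_div_nhds_zero.add_const a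
      rw [zero_add] at h1
      refine h1.congr' ?_
      filter_upwards [self_mem_nhdsWithin] with z (hz0 : z ≠ 0)
      have := pow_ne_zero n hz0
      field_simp
      ring
  · intro z hz
    rw [Function.update_of_ne hz]
    have := pow_ne_zero n hz
    field_simp
    ring

/-- If `f z = z ^ p * u z` near `z ≠ 0`, then `f' / f = p / z + u' / u` at `z`. -/
theorem deriv_div_eq_of_eventuallyEq_pow_mul {f u : ℂ → ℂ} {z u' : ℂ} {p : ℕ}
    (hf : f =ᶠ[𝓝 z] fun w => w ^ p * u w) (hz : z ≠ 0) (hu : HasDerivAt u u' z)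
    (hu0 : u z ≠ 0) : deriv f z / f z = p / z + u' / u z := by
  rw [hf.deriv_eq, hf.eq_of_nhds, ((hasDerivAt_pow p z).fun_mul hu).deriv]
  have := pow_ne_zero p hz
  cases p with
  | zero => simp
  | succ n =>
    simp only [Nat.add_sub_cancel]
    field_simp
    ring

/-- A property that holds on a punctured neighbourhood of `a` holds near each point of a smaller
punctured neighbourhood. -/
theorem eventually_nhds_of_eventually_nhdsNE {X : Type*} [TopologicalSpace X] [T1Space X] {a : X}
    {r : X → Prop} (h : ∀ᶠ x in 𝓝[≠] a, r x) : ∀ᶠ x in 𝓝[≠] a, ∀ᶠ y in 𝓝 x, r y := by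
  filter_upwards [self_mem_nhdsWithin, eventually_eventually_nhdsWithin.mpr h] with x hx hr
  rwa [isOpen_compl_singleton.nhdsWithin_eq hx] at hr

/-- The logarithmic derivative of `ρ` factors as `z ^ q` times a function with an explicit limit,
where `m = p + 1` and `l = q + 1`. -/
theorem eventually_logDeriv_rho_eq {p q : ℕ} {F h : ℂ → ℂ} (hh : AnalyticAt ℂ h 0)
    (hF : ∀ z, z ≠ 0 → F z = -z ^ (p + 1) + z ^ (p + 1 + (q + 1)) * h z) :
    ∃ B : ℂ → ℂ, ContinuousAt B 0 ∧
      B 0 = h 0 / (p + 1) * ((p + 1) + (q + 1)) * ((p + 1) - (q + 1)) ∧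
      ∀ᶠ z in 𝓝[≠] (0 : ℂ),
        deriv (deriv F) z / deriv F z
          - deriv (deriv fun w : ℂ => w ^ (p + 1)) z / deriv (fun w : ℂ => w ^ (p + 1)) z
          + 2 * (deriv (fun w : ℂ => w ^ (p + 1)) z + deriv F z) / (z ^ (p + 1) - F z)
          = z ^ q * B z := by
  set k : ℂ → ℂ := fun z => (p + 1 + (q + 1)) * h z + z * deriv h z with hk
  have hka : AnalyticAt ℂ k 0 :=
    (analyticAt_const.mul hh).add (analyticAt_id.mul hh.deriv)
  set u : ℂ → ℂ := fun z => -(p + 1) + z ^ (q + 1) * k z with hu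
  set v : ℂ → ℂ := fun z => 2 - z ^ (q + 1) * h z with hv
  have hp : (p + 1 : ℂ) ≠ 0 := by exact_mod_cast p.succ_ne_zero
  have hu0 : u 0 = -(p + 1) := by simp [hu]
  have hv0 : v 0 = 2 := by simp [hv]
  have huc : ContinuousAt u 0 :=
    continuousAt_const.add ((continuousAt_id.pow _).mul hka.continuousAt)
  have hvc : ContinuousAt v 0 :=
    continuousAt_const.sub ((continuousAt_id.pow _).mul hh.continuousAt)
  have hu0' : u 0 ≠ 0 := by rw [hu0]; exact neg_ne_zero.mpr hp
  have hv0' : v 0 ≠ 0 := by rw [hv0]; exact two_ne_zero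
  refine ⟨fun z => ((q + 1) * k z + z * deriv k z) / u z + 2 * k z / v z, ?_, ?_, ?_⟩
  · exact (((continuousAt_const.mul hka.continuousAt).add
      (continuousAt_id.mul hka.deriv.continuousAt)).div huc hu0').add
      ((continuousAt_const.mul hka.continuousAt).div hvc hv0')
  · simp only [hu0, hv0, hk]
    field_simp
    ring
  have hdF : ∀ᶠ z in 𝓝[≠] (0 : ℂ), deriv F z = z ^ p * u z := by
    filter_upwards [self_mem_nhdsWithin, hh.eventually_analyticAt.filter_mono nhdsWithin_le_nhds]
      with z (hz : z ≠ 0) hhz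
    have he : F =ᶠ[𝓝 z] fun w => -w ^ (p + 1) + w ^ (p + 1 + (q + 1)) * h w := by
      filter_upwards [isOpen_ne.mem_nhds hz] with w hw using hF w hw
    rw [he.deriv_eq, ((hasDerivAt_pow (p + 1) z).fun_neg.fun_add
      ((hasDerivAt_pow (p + 1 + (q + 1)) z).fun_mul hhz.differentiableAt.hasDerivAt)).deriv]
    simp only [hu, hk, ← add_assoc, Nat.add_sub_cancel]
    push_cast
    ring
  filter_upwards [self_mem_nhdsWithin, eventually_nhds_of_eventually_nhdsNE hdF, hdF,
    hka.eventually_analyticAt.filter_mono nhdsWithin_le_nhds,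
    (huc.eventually_ne hu0').filter_mono nhdsWithin_le_nhds,
    (hvc.eventually_ne hv0').filter_mono nhdsWithin_le_nhds] with z (hz : z ≠ 0) hev hFz hkz huz hvz
  have hev' : deriv F =ᶠ[𝓝 z] fun w => w ^ p * u w := hev
  have hud : HasDerivAt u (((q + 1 : ℕ) : ℂ) * z ^ q * k z + z ^ (q + 1) * deriv k z) z := by
    simpa [hu] using ((hasDerivAt_pow (q + 1) z).fun_mul
      hkz.differentiableAt.hasDerivAt).const_add (-(p + 1 : ℂ))
  have hdG : (deriv fun w : ℂ => w ^ (p + 1)) = fun w => w ^ p * ((p : ℂ) + 1) := by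
    ext w
    simp [mul_comm]
  have hGG : deriv (deriv fun w : ℂ => w ^ (p + 1)) z / deriv (fun w : ℂ => w ^ (p + 1)) z
      = p / z := by
    rw [deriv_div_eq_of_eventuallyEq_pow_mul (Filter.EventuallyEq.of_eq hdG) hz
      (hasDerivAt_const z _) hp]
    simp
  have hsub : z ^ (p + 1) - F z = z ^ (p + 1) * v z := by
    rw [hF z hz]
    simp only [hv]
    ring
  have hadd : deriv (fun w : ℂ => w ^ (p + 1)) z + deriv F z = z ^ (p + 1) * (z ^ q * k z) := by
    rw [hFz, hdG]
    simp only [hu]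
    ring
  rw [deriv_div_eq_of_eventuallyEq_pow_mul hev' hz hud huz, hGG, hsub, hadd]
  have := pow_ne_zero p hz
  field_simp
  push_cast
  ring

/-- With `G(z) = z^m` and `G_*(z) = −z^m + α₁z^{m+l} + o(z^{m+l})` (the
normalized cylindrical case), the logarithmic-derivative expression
`ρ′/ρ = G_*″/G_*′ − G″/G′ + 2(G′+G_*′)/(G−G_*)` satisfies
`z^{1−l}·(ρ′/ρ) → (α₁/m)(m+l)(m−l) ≠ 0` as `z → 0`; hence `ρ′/ρ` vanishes to
order exactly `l − 1` at `0`. -/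
theorem stmt9 (m l : ℕ) (hm : 0 < m) (hl : 0 < l) (hml : l ≠ m)
    (α₁ : ℂ) (hα₁ : α₁ ≠ 0) (ε : ℝ) (hε : 0 < ε)
    (G Gs : ℂ → ℂ)
    (hG : ∀ z, G z = z ^ m)
    (hGshol : DifferentiableOn ℂ Gs (Metric.ball 0 ε))
    (hGsexp : (fun z : ℂ => Gs z - (-z ^ m + α₁ * z ^ (m + l))) =o[𝓝[≠] (0 : ℂ)]
      fun z : ℂ => z ^ (m + l))
    (hne : ∀ z ∈ Metric.ball (0 : ℂ) ε \ {0}, G z ≠ Gs z) :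
    Filter.Tendsto
      (fun z : ℂ => z ^ ((1 : ℤ) - (l : ℤ)) *
        (deriv (deriv Gs) z / deriv Gs z - deriv (deriv G) z / deriv G z +
          2 * (deriv G z + deriv Gs z) / (G z - Gs z)))
      (𝓝[≠] (0 : ℂ)) (𝓝 ((α₁ / (m : ℂ)) * ((m : ℂ) + (l : ℂ)) * ((m : ℂ) - (l : ℂ)))) ∧
    (α₁ / (m : ℂ)) * ((m : ℂ) + (l : ℂ)) * ((m : ℂ) - (l : ℂ)) ≠ 0 ∧
    Filter.Tendsto
      (fun z : ℂ =>
        (deriv (deriv Gs) z / deriv Gs z - deriv (deriv G) z / deriv G z +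
          2 * (deriv G z + deriv Gs z) / (G z - Gs z)) / z ^ (l - 1))
      (𝓝[≠] (0 : ℂ)) (𝓝 ((α₁ / (m : ℂ)) * ((m : ℂ) + (l : ℂ)) * ((m : ℂ) - (l : ℂ)))) := by
  obtain ⟨p, rfl⟩ : ∃ p, m = p + 1 := ⟨m - 1, by omega⟩
  obtain ⟨q, rfl⟩ : ∃ q, l = q + 1 := ⟨l - 1, by omega⟩
  obtain rfl : G = fun z => z ^ (p + 1) := funext hG
  have hdiff : ∀ᶠ z in 𝓝[≠] (0 : ℂ), DifferentiableAt ℂ Gs z := by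
    filter_upwards [nhdsWithin_le_nhds (Metric.ball_mem_nhds (0 : ℂ) hε)] with z hz
    exact hGshol.differentiableAt (Metric.isOpen_ball.mem_nhds hz)
  obtain ⟨h, hh, rfl, hF⟩ := exists_analyticAt_eq_add_pow_mul hdiff
    (P := fun z => -z ^ (p + 1)) (by fun_prop) hGsexp
  obtain ⟨B, hB, hB0, hBe⟩ := eventually_logDeriv_rho_eq hh hF
  have hlim : Tendsto B (𝓝[≠] 0) (𝓝 (h 0 / ((p + 1 : ℕ) : ℂ) *
      (((p + 1 : ℕ) : ℂ) + ((q + 1 : ℕ) : ℂ)) * (((p + 1 : ℕ) : ℂ) - ((q + 1 : ℕ) : ℂ)))) := by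
    push_cast
    rw [← hB0]
    exact hB.tendsto.mono_left nhdsWithin_le_nhds
  refine ⟨hlim.congr' ?_, ?_, hlim.congr' ?_⟩
  · filter_upwards [hBe, self_mem_nhdsWithin] with z hz (hz0 : z ≠ 0)
    rw [hz, show (1 : ℤ) - ((q + 1 : ℕ) : ℤ) = -(q : ℤ) by push_cast; ring, zpow_neg, zpow_natCast,
      inv_mul_cancel_left₀ (pow_ne_zero q hz0)]
  · refine mul_ne_zero (mul_ne_zero (div_ne_zero hα₁ ?_) ?_) ?_
    · exact_mod_cast p.succ_ne_zero
    · norm_cast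
    · rw [sub_ne_zero]
      exact_mod_cast hml.symm
  · filter_upwards [hBe, self_mem_nhdsWithin] with z hz (hz0 : z ≠ 0)
    rw [hz, Nat.add_sub_cancel, mul_div_cancel_left₀ _ (pow_ne_zero q hz0)]
end

section
/- Let m be a positive integer, c ∈ ℂ with c ≠ 0, and α ∈ ℂ with α ≠ 1. Let G, G_* be holomorphic functions on a disc D around 0 with G(0) = G_*(0) = 0, G(z) = c·z^m + o(z^m) and G_*(z) = α·c·z^m + o(z^m) as z → 0, and G(z) ≠ G_*(z) for z ∈ D \ {0}. Then lim_{z→0} z·(G_*(z)·G′(z) + G(z)·G_*′(z))/(G(z) − G_*(z))² = 2mα/(1 − α)²; equivalently, for all sufficiently small ε > 0, (2πi)⁻¹·∮_{|z|=ε} (G_*G′ + GG_*′)/(G − G_*)² dz = 2mα/(1 − α)². -/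
open Filter Topology Asymptotics

/-- If `G` is holomorphic on a punctured disc and `G(z) = cz^m + o(z^m)`, then
`G(z)/z^m → c` and the expansion can be differentiated: `zG′(z)/z^m → mc`. -/
theorem tendsto_div_pow_and_mul_deriv_div_pow {m : ℕ} {c : ℂ} {G : ℂ → ℂ}
    (hG : ∀ᶠ z in 𝓝[≠] (0 : ℂ), DifferentiableAt ℂ G z)
    (hexp : (fun z : ℂ => G z - c * z ^ m) =o[𝓝[≠] (0 : ℂ)] fun z : ℂ => z ^ m) :
    Tendsto (fun z => G z / z ^ m) (𝓝[≠] (0 : ℂ)) (𝓝 c) ∧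
      Tendsto (fun z => z * deriv G z / z ^ m) (𝓝[≠] (0 : ℂ)) (𝓝 (m * c)) := by
  have hlim : Tendsto (fun z => G z / z ^ m) (𝓝[≠] (0 : ℂ)) (𝓝 c) := by
    have h := hexp.tendsto_div_nhds_zero.add_const c
    rw [zero_add] at h
    refine h.congr' ?_
    filter_upwards [self_mem_nhdsWithin] with z (hz : z ≠ 0)
    field_simp
    ring
  refine ⟨hlim, ?_⟩
  set g : ℂ → ℂ := Function.update (fun z => G z / z ^ m) 0 c with hg
  have hgz : ∀ z ≠ 0, g z = G z / z ^ m := fun z hz => by simp [hg, hz]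
  have hgcont : ContinuousAt g 0 := continuousAt_update_same.2 hlim
  have hgan : AnalyticAt ℂ g 0 := by
    refine Complex.analyticAt_of_differentiable_on_punctured_nhds_of_continuousAt ?_ hgcont
    filter_upwards [hG, self_mem_nhdsWithin] with z hz (hz0 : z ≠ 0)
    refine (hz.div (differentiableAt_id.pow m) (pow_ne_zero m hz0)).congr_of_eventuallyEq ?_
    filter_upwards [eventually_ne_nhds hz0] with w hw using hgz w hw
  have hderiv : ∀ᶠ z in 𝓝[≠] (0 : ℂ), m * g z + z * deriv g z = z * deriv G z / z ^ m := by
    filter_upwards [hgan.eventually_analyticAt.filter_mono nhdsWithin_le_nhds,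
      self_mem_nhdsWithin] with z hz (hz0 : z ≠ 0)
    have hEq : G =ᶠ[𝓝 z] fun w => w ^ m * g w := by
      filter_upwards [eventually_ne_nhds hz0] with w hw
      rw [hgz w hw]
      field_simp
    have hd := ((hasDerivAt_pow m z).mul hz.differentiableAt.hasDerivAt).congr_of_eventuallyEq hEq
    rw [hd.deriv]
    rcases m with _ | m
    · simp
    · rw [Nat.add_sub_cancel]
      field_simp
      ring
  refine Tendsto.congr' hderiv ?_
  have hcont : ContinuousAt (fun z => m * g z + z * deriv g z) 0 :=
    (continuousAt_const.mul hgcont).add (continuousAt_id.mul hgan.deriv.continuousAt)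
  have h := hcont.tendsto.mono_left (nhdsWithin_le_nhds (s := {0}ᶜ))
  simpa [hg] using h

/-- If `G(z) = cz^m + o(z^m)` and `G_*(z) = αcz^m + o(z^m)` (`c ≠ 0`, `α ≠ 1`)
with `G ≠ G_*` off the origin, then
`z·(G_*G′ + GG_*′)/(G − G_*)² → 2mα/(1 − α)²` as `z → 0`; equivalently
`(2πi)⁻¹∮_{|z|=ε} (G_*G′ + GG_*′)/(G − G_*)² dz = 2mα/(1 − α)²` for small `ε`. -/
theorem stmt11 (m : ℕ) (hm : 0 < m) (c α : ℂ) (hc : c ≠ 0) (hα : α ≠ 1)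
    (R : ℝ) (hR : 0 < R) (G Gs : ℂ → ℂ)
    (hGhol : DifferentiableOn ℂ G (Metric.ball 0 R))
    (hGshol : DifferentiableOn ℂ Gs (Metric.ball 0 R))
    (hG0 : G 0 = 0) (hGs0 : Gs 0 = 0)
    (hGexp : (fun z : ℂ => G z - c * z ^ m) =o[𝓝[≠] (0 : ℂ)] fun z : ℂ => z ^ m)
    (hGsexp : (fun z : ℂ => Gs z - α * c * z ^ m) =o[𝓝[≠] (0 : ℂ)] fun z : ℂ => z ^ m)
    (hne : ∀ z ∈ Metric.ball (0 : ℂ) R \ {0}, G z ≠ Gs z) :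
    Filter.Tendsto
      (fun z : ℂ => z * (Gs z * deriv G z + G z * deriv Gs z) / (G z - Gs z) ^ 2)
      (𝓝[≠] (0 : ℂ)) (𝓝 (2 * (m : ℂ) * α / (1 - α) ^ 2)) ∧
    ∃ ε₀ > 0, ∀ ε : ℝ, 0 < ε → ε < ε₀ →
      (2 * Real.pi * Complex.I)⁻¹ *
        circleIntegral
          (fun z => (Gs z * deriv G z + G z * deriv Gs z) / (G z - Gs z) ^ 2)
          0 ε = 2 * (m : ℂ) * α / (1 - α) ^ 2 := by
  have hball : Metric.ball (0 : ℂ) R ∈ 𝓝 (0 : ℂ) := Metric.ball_mem_nhds 0 hR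
  have hdiff : ∀ F : ℂ → ℂ, DifferentiableOn ℂ F (Metric.ball 0 R) →
      ∀ᶠ z in 𝓝[≠] (0 : ℂ), DifferentiableAt ℂ F z := fun F hF => by
    filter_upwards [nhdsWithin_le_nhds hball] with z hz
    exact hF.differentiableAt (Metric.isOpen_ball.mem_nhds hz)
  obtain ⟨hG, hG'⟩ := tendsto_div_pow_and_mul_deriv_div_pow (hdiff G hGhol) hGexp
  obtain ⟨hGs, hGs'⟩ := tendsto_div_pow_and_mul_deriv_div_pow (hdiff Gs hGshol) hGsexp
  have h1α : 1 - α ≠ 0 := sub_ne_zero.2 hα.symm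
  have hcα : (c - α * c) ^ 2 ≠ 0 := by
    rw [show c - α * c = c * (1 - α) by ring]
    exact pow_ne_zero 2 (mul_ne_zero hc h1α)
  have hlim : Tendsto
      (fun z : ℂ => z * (Gs z * deriv G z + G z * deriv Gs z) / (G z - Gs z) ^ 2)
      (𝓝[≠] (0 : ℂ)) (𝓝 (2 * (m : ℂ) * α / (1 - α) ^ 2)) := by
    have h := ((hGs.mul hG').add (hG.mul hGs')).div ((hG.sub hGs).pow 2) hcα
    have hval : (α * c * (m * c) + c * (m * (α * c))) / (c - α * c) ^ 2 =
        2 * (m : ℂ) * α / (1 - α) ^ 2 := by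
      rw [show c - α * c = c * (1 - α) by ring]
      field_simp
      ring
    rw [hval] at h
    refine h.congr' ?_
    filter_upwards [nhdsWithin_le_nhds hball, self_mem_nhdsWithin] with z hz (hz0 : z ≠ 0)
    have hsub : G z - Gs z ≠ 0 := sub_ne_zero.2 (hne z ⟨hz, hz0⟩)
    simp only [Pi.div_apply, ← sub_div]
    field_simp
  refine ⟨hlim, R, hR, fun ε hε hεR => ?_⟩
  have hdiffAt : ∀ z ∈ Metric.ball (0 : ℂ) R \ {0}, DifferentiableAt ℂ
      (fun z : ℂ => z * (Gs z * deriv G z + G z * deriv Gs z) / (G z - Gs z) ^ 2) z := by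
    intro z hz
    have hzn := Metric.isOpen_ball.mem_nhds hz.1
    have dG := hGhol.differentiableAt hzn
    have dGs := hGshol.differentiableAt hzn
    have dG' := (hGhol.deriv Metric.isOpen_ball).differentiableAt hzn
    have dGs' := (hGshol.deriv Metric.isOpen_ball).differentiableAt hzn
    exact (differentiableAt_id.mul ((dGs.mul dG').add (dG.mul dGs'))).div ((dG.sub dGs).pow 2)
      (pow_ne_zero 2 (sub_ne_zero.2 (hne z hz)))
  have hint :=
    Complex.circleIntegral_sub_center_inv_smul_of_differentiable_on_off_countable_of_tendsto
      hε Set.countable_empty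
      (fun z hz => (hdiffAt z
        ⟨Metric.closedBall_subset_ball hεR hz.1, hz.2⟩).continuousAt.continuousWithinAt)
      (fun z hz => hdiffAt z ⟨Metric.ball_subset_ball hεR.le hz.1.1, hz.1.2⟩) hlim
  have hcongr : circleIntegral
      (fun z => (Gs z * deriv G z + G z * deriv Gs z) / (G z - Gs z) ^ 2) 0 ε =
      2 * Real.pi * Complex.I * (2 * (m : ℂ) * α / (1 - α) ^ 2) := by
    rw [← smul_eq_mul, ← hint]
    refine circleIntegral.integral_congr hε.le fun z hz => ?_
    have hz0 : z ≠ 0 := ne_zero_of_mem_sphere hε.ne' ⟨z, hz⟩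
    simp only [sub_zero, smul_eq_mul, mul_div_assoc]
    rw [inv_mul_cancel_left₀ hz0]
  rw [hcongr, inv_mul_cancel_left₀ Complex.two_pi_I_ne_zero]
end

section
/- Let m, l be positive integers with l > m, let α ∈ ℂ with α ∉ {0, 1}, and α₁ ∈ ℂ. Let G(z) = z^m, and let G_* be holomorphic on a disc D around 0 with G_*(z) = α·z^m + α₁·z^{m+l} + o(z^{m+l}) as z → 0, and G(z) ≠ G_*(z) for z ∈ D \ {0}. Then the residue at 0 of (G′ + G_*′)/(G − G_*)² vanishes: for all sufficiently small ε > 0, ∮_{|z|=ε} (G′(z) + G_*′(z))/(G(z) − G_*(z))² dz = 0. -/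
open Filter Topology Asymptotics

/-- A function holomorphic on a ball whose difference from `p + a z ^ n` is `o(z ^ n)` agrees, away
from the centre, with `p + z ^ n * k` for some holomorphic `k`. -/
theorem DifferentiableOn.exists_eq_add_pow_mul_of_isLittleO {f p : ℂ → ℂ} {R : ℝ} (hR : 0 < R)
    {n : ℕ} {a : ℂ} (hf : DifferentiableOn ℂ f (Metric.ball 0 R))
    (hp : DifferentiableOn ℂ p (Metric.ball 0 R))
    (h : (fun z : ℂ => f z - (p z + a * z ^ n)) =o[𝓝[≠] (0 : ℂ)] fun z : ℂ => z ^ n) :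
    ∃ k : ℂ → ℂ, DifferentiableOn ℂ k (Metric.ball 0 R) ∧
      ∀ z ≠ 0, f z = p z + z ^ n * k z := by
  refine ⟨Function.update (fun z => (f z - p z) / z ^ n) 0 a, ?_, fun z hz => ?_⟩
  · rw [← Complex.differentiableOn_compl_singleton_and_continuousAt_iff
      (Metric.ball_mem_nhds (0 : ℂ) hR)]
    constructor
    · refine DifferentiableOn.congr (f := fun z => (f z - p z) / z ^ n) ?_ fun z hz =>
        Function.update_of_ne hz.2 _ _
      exact ((hf.sub hp).mono Set.sdiff_subset).div (by fun_prop) fun z hz => pow_ne_zero _ hz.2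
    · rw [continuousAt_update_same]
      have h0 := h.tendsto_div_nhds_zero.add_const a
      rw [zero_add] at h0
      refine h0.congr' ?_
      filter_upwards [self_mem_nhdsWithin] with z hz
      have hz : z ≠ 0 := hz
      field_simp
      ring
  · rw [Function.update_of_ne hz]
    field_simp
    ring

/-- For a centered end normalized so that `G(z) = z^m` and
`G_*(z) = αz^m + α₁z^{m+l} + o(z^{m+l})` with `l > m` and `α ∉ {0,1}`, the
residue at `0` of `(G′ + G_*′)/(G − G_*)²` vanishes: its contour integrals over
small circles around `0` are zero. -/
theorem stmt12 (m l : ℕ) (hm : 0 < m) (hml : m < l)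
    (α α₁ : ℂ) (hα0 : α ≠ 0) (hα1 : α ≠ 1)
    (R : ℝ) (hR : 0 < R) (G Gs : ℂ → ℂ)
    (hG : ∀ z, G z = z ^ m)
    (hGshol : DifferentiableOn ℂ Gs (Metric.ball 0 R))
    (hGsexp : (fun z : ℂ => Gs z - (α * z ^ m + α₁ * z ^ (m + l))) =o[𝓝[≠] (0 : ℂ)]
      fun z : ℂ => z ^ (m + l))
    (hne : ∀ z ∈ Metric.ball (0 : ℂ) R \ {0}, G z ≠ Gs z) :
    ∃ ε₀ > 0, ∀ ε : ℝ, 0 < ε → ε < ε₀ →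
      circleIntegral (fun z => (deriv G z + deriv Gs z) / (G z - Gs z) ^ 2) 0 ε = 0 := by
  obtain rfl : G = fun z => z ^ m := funext hG
  obtain ⟨k, hk, hGs⟩ := hGshol.exists_eq_add_pow_mul_of_isLittleO hR
    (p := fun z => α * z ^ m) (by fun_prop) hGsexp
  have hα : 1 - α ≠ 0 := sub_ne_zero.2 hα1.symm
  have hw : ∀ z ∈ Metric.ball (0 : ℂ) R, 1 - α - z ^ l * k z ≠ 0 := by
    intro z hz hzero
    rcases eq_or_ne z 0 with rfl | hz0
    · rw [zero_pow (by omega), zero_mul, sub_zero] at hzero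
      exact hα hzero
    · refine hne z ⟨hz, hz0⟩ ?_
      rw [hGs z hz0]
      linear_combination z ^ m * hzero
  have hk' : DifferentiableOn ℂ (deriv k) (Metric.ball 0 R) := hk.deriv Metric.isOpen_ball
  -- The regular part of the integrand.
  let A : ℂ → ℂ := fun z => z ^ (l - m - 1) *
    ((m * k z * ((1 - α) ^ 2 + 2 * (1 + α) * (1 - α) - (1 + α) * (z ^ l * k z)) / (1 - α) ^ 2
      + (l * k z + z * deriv k z)) / (1 - α - z ^ l * k z) ^ 2)
  have hA : DifferentiableOn ℂ A (Metric.ball 0 R) := by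
    refine DifferentiableOn.mul (by fun_prop) (DifferentiableOn.div (by fun_prop) (by fun_prop) ?_)
    exact fun z hz => pow_ne_zero _ (hw z hz)
  refine ⟨R, hR, fun ε hε hεR => ?_⟩
  have hsub : Metric.closedBall (0 : ℂ) ε ⊆ Metric.ball 0 R := Metric.closedBall_subset_ball hεR
  let B : ℂ → ℂ := fun z => (m * (1 + α) / (1 - α) ^ 2) * (z - 0) ^ (-(m + 1 : ℤ))
  have hne0 : ∀ z ∈ Metric.sphere (0 : ℂ) ε, z ≠ 0 := fun z hz =>
    Metric.ne_of_mem_sphere hz hε.ne'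
  have hAB : Set.EqOn (fun z => (deriv (fun z : ℂ => z ^ m) z + deriv Gs z) / (z ^ m - Gs z) ^ 2)
      (fun z => B z + A z) (Metric.sphere 0 ε) := by
    intro z hz
    have hz0 := hne0 z hz
    have hzR := hsub (Metric.sphere_subset_closedBall hz)
    have hkz : HasDerivAt k (deriv k z) z :=
      (hk.differentiableAt (Metric.isOpen_ball.mem_nhds hzR)).hasDerivAt
    have hd : deriv Gs z = α * (m * z ^ (m - 1)) +
        (((m + l : ℕ) : ℂ) * z ^ (m + l - 1) * k z + z ^ (m + l) * deriv k z) := by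
      have hev : Gs =ᶠ[𝓝 z] fun z => α * z ^ m + z ^ (m + l) * k z := by
        filter_upwards [isOpen_ne.mem_nhds hz0] with y hy using hGs y hy
      rw [hev.deriv_eq]
      exact (((hasDerivAt_pow m z).const_mul α).add ((hasDerivAt_pow (m + l) z).mul hkz)).deriv
    have hdG : deriv (fun z : ℂ => z ^ m) z = m * z ^ (m - 1) := (hasDerivAt_pow m z).deriv
    have hwz := hw z hzR
    obtain ⟨j, rfl⟩ : ∃ j, m = j + 1 := ⟨m - 1, by omega⟩
    obtain ⟨i, rfl⟩ : ∃ i, l = j + 1 + 1 + i := ⟨l - (j + 2), by omega⟩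
    have e1 : j + 1 + 1 + i - (j + 1) - 1 = i := by omega
    have e2 : j + 1 + (j + 1 + 1 + i) - 1 = j + j + i + 2 := by omega
    have e3 : z ^ (j + 1) - Gs z = z ^ (j + 1) * (1 - α - z ^ (j + 1 + 1 + i) * k z) := by
      rw [hGs z hz0]; ring
    have e4 : (z - 0) ^ (-((j + 1 : ℕ) + 1 : ℤ)) = (z ^ (j + 2))⁻¹ := by
      rw [sub_zero, zpow_neg]; norm_cast
    simp only [A, B, hd, hdG, e1, e2, e3, e4, Nat.add_sub_cancel]
    generalize k z = u at *
    generalize deriv k z = v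
    push_cast
    set W := 1 - α - z ^ (j + 1 + 1 + i) * u with hW
    field_simp
    rw [hW]
    ring
  rw [circleIntegral.integral_congr hε.le hAB, circleIntegral.integral_add]
  · have hBint : circleIntegral B 0 ε = 0 := by
      rw [circleIntegral.integral_const_mul, circleIntegral.integral_sub_zpow_of_ne (by omega),
        mul_zero]
    rw [hBint, zero_add]
    exact Complex.circleIntegral_eq_zero_of_differentiable_on_off_countable hε.le
      Set.countable_empty (hA.continuousOn.mono hsub) fun z hz => hA.differentiableAt
        (Metric.isOpen_ball.mem_nhds (hsub (Metric.ball_subset_closedBall hz.1)))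
  · refine ContinuousOn.circleIntegrable hε.le (ContinuousOn.mul continuousOn_const ?_)
    exact ContinuousOn.zpow₀ (by fun_prop) _ fun z hz => Or.inl (by simpa using hne0 z hz)
  · exact ContinuousOn.circleIntegrable hε.le
      (hA.continuousOn.mono (Metric.sphere_subset_closedBall.trans hsub))
end

section
/- Let m, l be positive integers with l > m, let α ∈ ℂ with α ∉ {0, 1}, α₁ ∈ ℂ, and a ∈ ℂ with a ≠ 0. Let G(z) = z^m and let G_* be holomorphic near 0 with G_*(z) = α·z^m + α₁·z^{m+l} + o(z^{m+l}) as z → 0. Define, near 0, A(z) = ( (1 − G(z)/a) / (1 − G_*(z)/a) )² · G_*′(z)/G′(z). Then lim_{z→0} z^{−m}·(A(z) − α) = −2α(1 − α)/a, which is nonzero; in particular, A − A(0) vanishes to order exactly m at z = 0. -/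
open Filter Topology Asymptotics

/-- An analytic function that is `O(z ^ n)` near `0` is divisible by `z ^ n`. -/
theorem AnalyticAt.exists_eventuallyEq_pow_mul_of_isBigO {f : ℂ → ℂ} {n : ℕ}
    (hf : AnalyticAt ℂ f 0) (hO : f =O[𝓝[≠] (0 : ℂ)] fun z : ℂ => z ^ n) :
    ∃ g : ℂ → ℂ, AnalyticAt ℂ g 0 ∧ ∀ᶠ z in 𝓝 (0 : ℂ), f z = z ^ n * g z := by
  suffices h : (n : ℕ∞) ≤ analyticOrderAt f 0 by
    simpa using (natCast_le_analyticOrderAt hf).1 h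
  by_contra! hlt
  obtain ⟨k, hk⟩ := ENat.ne_top_iff_exists.1 hlt.ne_top
  rw [← hk, Nat.cast_lt] at hlt
  obtain ⟨g, hg, hg0, hfg⟩ := hf.analyticOrderAt_eq_natCast.1 hk.symm
  have hgO : g =O[𝓝[≠] (0 : ℂ)] fun z : ℂ => z ^ (n - k) := by
    refine ((isBigO_refl (fun z : ℂ => (z ^ k)⁻¹) (𝓝[≠] (0 : ℂ))).mul hO).congr' ?_ ?_
    · filter_upwards [hfg.filter_mono nhdsWithin_le_nhds, self_mem_nhdsWithin] with z hz hz0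
      have hz0 : z ≠ 0 := hz0
      rw [hz, sub_zero, smul_eq_mul, inv_mul_cancel_left₀ (pow_ne_zero k hz0)]
    · filter_upwards [self_mem_nhdsWithin] with z hz0
      have hz0 : z ≠ 0 := hz0
      rw [pow_sub₀ z hz0 hlt.le, mul_comm]
  have hpow : Tendsto (fun z : ℂ => z ^ (n - k)) (𝓝[≠] (0 : ℂ)) (𝓝 0) := by
    have h : ContinuousAt (fun z : ℂ => z ^ (n - k)) 0 := by fun_prop
    simpa [ContinuousAt, (Nat.sub_pos_of_lt hlt).ne'] using h.tendsto.mono_left nhdsWithin_le_nhds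
  exact hg0 (tendsto_nhds_unique (hg.continuousAt.tendsto.mono_left nhdsWithin_le_nhds)
    (hgO.trans_tendsto hpow))

/-- With `G(z) = z^m`, `G_*(z) = αz^m + α₁z^{m+l} + o(z^{m+l})` (`l > m`,
`α ∉ {0,1}`) and `a ≠ 0`, the ratio
`A = ((1 − G/a)/(1 − G_*/a))²·G_*′/G′` of the Möbius-transformed Gauss-map
differentials satisfies `z^{−m}(A(z) − α) → −2α(1−α)/a ≠ 0`; in particular
`A − α` vanishes to order exactly `m` at `0`. -/
theorem stmt13 (m l : ℕ) (hm : 0 < m) (hml : m < l)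
    (α α₁ a : ℂ) (hα0 : α ≠ 0) (hα1 : α ≠ 1) (ha : a ≠ 0)
    (R : ℝ) (hR : 0 < R) (G Gs : ℂ → ℂ)
    (hG : ∀ z, G z = z ^ m)
    (hGshol : DifferentiableOn ℂ Gs (Metric.ball 0 R))
    (hGsexp : (fun z : ℂ => Gs z - (α * z ^ m + α₁ * z ^ (m + l))) =o[𝓝[≠] (0 : ℂ)]
      fun z : ℂ => z ^ (m + l))
    (A : ℂ → ℂ)
    (hA : A = fun z => ((1 - G z / a) / (1 - Gs z / a)) ^ 2 * (deriv Gs z / deriv G z)) :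
    Filter.Tendsto (fun z : ℂ => z ^ (-(m : ℤ)) * (A z - α)) (𝓝[≠] (0 : ℂ))
      (𝓝 (-2 * α * (1 - α) / a)) ∧
    -2 * α * (1 - α) / a ≠ 0 ∧
    ∃ c : ℂ, c ≠ 0 ∧
      Filter.Tendsto (fun z : ℂ => (A z - α) / z ^ m) (𝓝[≠] (0 : ℂ)) (𝓝 c) := by
  have hlim_ne : -2 * α * (1 - α) / a ≠ 0 :=
    div_ne_zero (mul_ne_zero (mul_ne_zero (by norm_num) hα0) (sub_ne_zero.2 hα1.symm)) ha
  have hGs0 : AnalyticAt ℂ Gs 0 := hGshol.analyticAt (Metric.ball_mem_nhds 0 hR)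
  have hO : (fun z : ℂ => Gs z - α * z ^ m) =O[𝓝[≠] (0 : ℂ)] fun z : ℂ => z ^ (m + l) := by
    have h := hGsexp.isBigO.add ((isBigO_refl (fun z : ℂ => z ^ (m + l)) _).const_mul_left α₁)
    exact h.congr_left fun z => by ring
  have hdiff : AnalyticAt ℂ (fun z : ℂ => Gs z - α * z ^ m) 0 := by fun_prop
  obtain ⟨g, hg, hfg⟩ := hdiff.exists_eventuallyEq_pow_mul_of_isBigO hO
  have hGs : Gs =ᶠ[𝓝 0] fun z => α * z ^ m + z ^ (m + l) * g z :=
    hfg.mono fun z hz => by linear_combination hz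
  have hm0 : (m : ℂ) ≠ 0 := Nat.cast_ne_zero.2 hm.ne'
  obtain ⟨d, rfl⟩ : ∃ d, l = m + d + 1 := ⟨l - m - 1, by omega⟩
  let k : ℂ → ℂ := fun z => ((m + (m + d + 1) : ℂ) * g z + z * deriv g z) / m
  have hderiv : ∀ᶠ z in 𝓝[≠] (0 : ℂ), deriv Gs z / deriv G z = α + z ^ (m + d + 1) * k z := by
    filter_upwards [hGs.eventuallyEq_nhds.filter_mono nhdsWithin_le_nhds,
      hg.eventually_analyticAt.filter_mono nhdsWithin_le_nhds, self_mem_nhdsWithin] with z hz hgz hz0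
    have hz0 : z ≠ 0 := hz0
    obtain ⟨n, rfl⟩ : ∃ n, m = n + 1 := ⟨m - 1, by omega⟩
    have h₁ := ((hasDerivAt_pow (n + 1) z).const_mul α).add
      ((hasDerivAt_pow (n + 1 + (n + 1 + d + 1)) z).mul hgz.differentiableAt.hasDerivAt)
    have h₂ : deriv G z = ((n + 1 : ℕ) : ℂ) * z ^ n := by
      rw [funext hG]; simp
    rw [(h₁.congr_of_eventuallyEq hz).deriv, h₂, div_eq_iff (mul_ne_zero hm0 (pow_ne_zero n hz0))]
    simp only [k, add_tsub_cancel_right, show n + 1 + (n + 1 + d + 1) - 1 = n + n + d + 2 by omega]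
    field_simp
    push_cast
    ring
  let F : ℂ → ℂ := fun z =>
    (z ^ (d + 1) * (1 - z ^ m / a) ^ 2 * k z
      + α * (α - 1 + z ^ (m + d + 1) * g z) / a * (2 - z ^ m / a - Gs z / a))
      / (1 - Gs z / a) ^ 2
  have hGs_zero : Gs 0 = 0 := by
    simpa [hm.ne'] using hGs.self_of_nhds
  have hF0 : F 0 = -2 * α * (1 - α) / a := by
    simp only [F, hGs_zero]
    simp [hm.ne']
    ring
  have hFcont : ContinuousAt F 0 := by
    have hg' := hg.deriv.continuousAt
    have hgc := hg.continuousAt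
    have hGsc := hGs0.continuousAt
    have hk : ContinuousAt k 0 := by fun_prop
    refine ContinuousAt.div (by fun_prop) (by fun_prop) ?_
    simp [hGs_zero]
  have hFeq : ∀ᶠ z in 𝓝[≠] (0 : ℂ), F z = (A z - α) / z ^ m := by
    have hne : ∀ᶠ z in 𝓝 (0 : ℂ), 1 - Gs z / a ≠ 0 := by
      have hc : ContinuousAt (fun z => 1 - Gs z / a) 0 := by
        have := hGs0.continuousAt
        fun_prop
      exact hc.eventually_ne (by simp [hGs_zero])
    filter_upwards [hderiv, hGs.filter_mono nhdsWithin_le_nhds,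
      hne.filter_mono nhdsWithin_le_nhds, self_mem_nhdsWithin] with z hz hGsz hnez hz0
    have hzm : z ^ m ≠ 0 := pow_ne_zero m hz0
    rw [eq_div_iff hzm]
    simp only [F, hA, hz, hG]
    rw [div_pow, div_mul_eq_mul_div (_ : ℂ) ((1 - Gs z / a) ^ 2),
      div_mul_eq_mul_div (_ : ℂ) ((1 - Gs z / a) ^ 2), div_sub' (pow_ne_zero 2 hnez)]
    congr 1
    rw [hGsz]
    ring
  have hlim : Tendsto (fun z : ℂ => (A z - α) / z ^ m) (𝓝[≠] (0 : ℂ))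
      (𝓝 (-2 * α * (1 - α) / a)) := by
    rw [← hF0]
    exact (hFcont.tendsto.mono_left nhdsWithin_le_nhds).congr' hFeq
  refine ⟨hlim.congr fun z => ?_, hlim_ne, _, hlim_ne, hlim⟩
  rw [zpow_neg, zpow_natCast, div_eq_inv_mul]
end
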